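/- Completeness under the tree property: if (S, Concat, Reg) is well-formed and acyclic, and Concat satisfies the tree property, then after forward-propagation the output Reg' satisfies: (∀ v, L(Reg' v) ≠ ∅) if and only if there exists an assignment μ with sat_str S Concat Reg μ. -/

import Mathlib

open Classical

variable {V a : Type}

/-- Concatenation of two languages. -/
def langConcat (L1 L2 : Set (List a)) : Set (List a) :=
  {w | ∃ w1 w2, w = w1 ++ w2 ∧ w1 ∈ L1 ∧ w2 ∈ L2}

/-- Well-formedness of a string constraint `(S, Concat, Reg)`:
`S` is finite and all variables mentioned by `Concat` lie in `S`
(`Reg` is a total map, so `dom Reg = S` is implicit). -/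
def WfConstr (S : Set V) (Concat : V → Set (V × V))
    (_Reg : V → Set (List a)) : Prop :=
  S.Finite ∧ ∀ v, (Concat v ≠ ∅ → v ∈ S) ∧
    ∀ p ∈ Concat v, p.1 ∈ S ∧ p.2 ∈ S

/-- The acyclicity predicate: `l` is a list of disjoint layers covering `S`,
each variable's dependencies lying in strictly later layers. -/
def Acyclic (Concat : V → Set (V × V)) : Set V → List (Set V) → Prop
  | S, [] => S = ∅
  | S, s :: l' =>
      S = s ∪ (⋃ t ∈ l', t) ∧
      Disjoint s (⋃ t ∈ l', t) ∧
      (∀ v ∈ s, ∀ p ∈ Concat v, p.1 ∈ (⋃ t ∈ l', t) ∧ p.2 ∈ (⋃ t ∈ l', t)) ∧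
      Acyclic Concat (S \ s) l'

/-- The set of variables of `S` all of whose dependence variables lie in `R`. -/
def ReadySet (S : Set V) (Concat : V → Set (V × V)) (R : Set V) : Set V :=
  {v ∈ S | ∀ p ∈ Concat v, p.1 ∈ R ∧ p.2 ∈ R}

/-- Refine the regular constraints of the variables in `C` by propagating
their concatenation constraints. -/
noncomputable def VarLang (C : Set V) (Concat : V → Set (V × V))
    (Reg : V → Set (List a)) : V → Set (List a) := fun v =>
  if v ∈ C then
    Reg v ∩ ⋂ p ∈ Concat v, langConcat (Reg p.1) (Reg p.2)
  else Reg v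

/-- The forward-propagation loop, with fuel. -/
noncomputable def ForwardPropAux (Concat : V → Set (V × V)) :
    ℕ → Set V → Set V → (V → Set (List a)) → (V → Set (List a))
  | 0, _, _, Reg => Reg
  | n + 1, S, R, Reg =>
      if S = ∅ then Reg
      else
        let C := ReadySet S Concat R
        ForwardPropAux Concat n (S \ C) (R ∪ C) (VarLang C Concat Reg)

/-- The forward-propagation algorithm. -/
noncomputable def ForwardProp (S : Set V) (Concat : V → Set (V × V))
    (Reg : V → Set (List a)) : V → Set (List a) :=
  ForwardPropAux Concat S.ncard S ∅ Reg

/-- Satisfiability of a string constraint by an assignment `μ`. -/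
def SatStr (S : Set V) (Concat : V → Set (V × V))
    (Reg : V → Set (List a)) (μ : V → List a) : Prop :=
  (∀ v ∈ S, μ v ∈ Reg v) ∧
  ∀ v ∈ S, ∀ p ∈ Concat v, μ v = μ p.1 ++ μ p.2

/-- The tree property for the concatenation-constraint map. -/
def TreeProp {V : Type} (Concat : V → Set (V × V)) : Prop :=
  (∀ v, ∀ p ∈ Concat v, p.1 ≠ p.2) ∧
  (∀ v, ∀ p ∈ Concat v, ∀ q ∈ Concat v, p ≠ q →
    ({p.1, p.2} ∩ {q.1, q.2} : Set V) = ∅) ∧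
  (∀ v v', v ≠ v' → ∀ p ∈ Concat v, ∀ q ∈ Concat v',
    ({p.1, p.2} ∩ {q.1, q.2} : Set V) = ∅)


theorem acyclic_rank {V : Type} (Concat : V → Set (V × V)) (l : List (Set V)) :
    ∀ S : Set V, Acyclic Concat S l → ∃ r : V → ℕ, (∀ v, r v ≤ l.length) ∧
      ∀ v ∈ S, ∀ p ∈ Concat v, (p.1 ∈ S ∧ p.2 ∈ S) ∧ r p.1 < r v ∧ r p.2 < r v := by
  induction l with
  | nil =>
    intro S h
    simp only [Acyclic] at h
    subst h
    exact ⟨fun _ => 0, by simp, by simp⟩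
  | cons s l ih =>
    intro S h
    simp only [Acyclic] at h
    obtain ⟨h1, h2, h3, h4⟩ := h
    obtain ⟨r, hr, hr2⟩ := ih _ h4
    generalize (⋃ t ∈ l, t) = U at *
    have hU : ∀ x ∈ U, x ∉ s := fun x hx hs => Set.disjoint_left.mp h2 hs hx
    refine ⟨fun v => if v ∈ s then l.length + 1 else r v, ?_, ?_⟩
    · intro v
      have := hr v
      dsimp only
      split_ifs <;> simp <;> omega
    · intro v hv p hp
      by_cases hs : v ∈ s
      · obtain ⟨a1, a2⟩ := h3 v hs p hp
        have b1 := hU _ a1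
        have b2 := hU _ a2
        have c1 := hr p.1
        have c2 := hr p.2
        simp only [hs, b1, b2, if_true, if_false]
        refine ⟨⟨h1 ▸ Or.inr a1, h1 ▸ Or.inr a2⟩, by omega, by omega⟩
      · obtain ⟨⟨a1, a2⟩, a3⟩ := hr2 v ⟨hv, hs⟩ p hp
        simp only [hs, a1.2, a2.2, if_false]
        exact ⟨⟨a1.1, a2.1⟩, a3⟩

theorem forwardPropAux_spec {V a : Type} (Concat : V → Set (V × V)) (r : V → ℕ) (n : ℕ) :
    ∀ (S R : Set V) (Reg : V → Set (List a)), S.Finite → S.ncard ≤ n → Disjoint R S →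
      (∀ v ∈ S, ∀ p ∈ Concat v, (p.1 ∈ R ∪ S ∧ p.2 ∈ R ∪ S) ∧ r p.1 < r v ∧ r p.2 < r v) →
      (∀ v, v ∉ S → ForwardPropAux Concat n S R Reg v = Reg v) ∧
      (∀ v ∈ S, ForwardPropAux Concat n S R Reg v = Reg v ∩ ⋂ p ∈ Concat v,
        langConcat (ForwardPropAux Concat n S R Reg p.1)
          (ForwardPropAux Concat n S R Reg p.2)) := by
  induction n with
  | zero =>
    intro S R Reg hf hc hd hS
    have : S = ∅ := by
      rw [← Set.ncard_eq_zero hf]; omega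
    subst this
    simp [ForwardPropAux]
  | succ n ih =>
    intro S R Reg hf hc hd hS
    by_cases hE : S = ∅
    · subst hE
      simp [ForwardPropAux]
    have hdis : ∀ x ∈ R, x ∉ S := fun x hx hs => Set.disjoint_left.mp hd hx hs
    have hsub : ReadySet S Concat R ⊆ S := fun x hx => hx.1
    have hne : (ReadySet S Concat R).Nonempty := by
      obtain ⟨v, hv, hmin⟩ := Set.exists_min_image S r hf (Set.nonempty_iff_ne_empty.mpr hE)
      refine ⟨v, hv, fun p hp => ?_⟩
      obtain ⟨⟨a1, a2⟩, a3, a4⟩ := hS v hv p hp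
      constructor
      · rcases a1 with h | h
        · exact h
        · have := hmin _ h; omega
      · rcases a2 with h | h
        · exact h
        · have := hmin _ h; omega
    have hunf : ForwardPropAux Concat (n+1) S R Reg =
        ForwardPropAux Concat n (S \ ReadySet S Concat R) (R ∪ ReadySet S Concat R)
          (VarLang (ReadySet S Concat R) Concat Reg) := by
      simp [ForwardPropAux, hE]
    rw [hunf]
    have hCdef : ∀ v ∈ ReadySet S Concat R, ∀ p ∈ Concat v, p.1 ∈ R ∧ p.2 ∈ R :=
      fun v hv => hv.2
    generalize ReadySet S Concat R = C at *
    have hlt : (S \ C).ncard < S.ncard := by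
      apply Set.ncard_lt_ncard _ hf
      refine ⟨Set.diff_subset, fun h => ?_⟩
      obtain ⟨x, hx⟩ := hne
      exact (h (hsub hx)).2 hx
    obtain ⟨i1, i2⟩ := ih (S \ C) (R ∪ C) (VarLang C Concat Reg) (hf.subset Set.diff_subset)
      (by omega)
      (by
        rw [Set.disjoint_left]
        rintro x (h | h) h'
        · exact hdis x h h'.1
        · exact h'.2 h)
      (by
        intro v hv p hp
        obtain ⟨⟨a1, a2⟩, a3⟩ := hS v hv.1 p hp
        refine ⟨⟨?_, ?_⟩, a3⟩
        · by_cases h : p.1 ∈ C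
          · exact Or.inl (Or.inr h)
          · exact a1.elim (fun h => Or.inl (Or.inl h)) (fun h' => Or.inr ⟨h', h⟩)
        · by_cases h : p.2 ∈ C
          · exact Or.inl (Or.inr h)
          · exact a2.elim (fun h => Or.inl (Or.inl h)) (fun h' => Or.inr ⟨h', h⟩))
    generalize ForwardPropAux Concat n (S \ C) (R ∪ C) (VarLang C Concat Reg) = out at *
    have o1 : ∀ v, v ∉ S → out v = Reg v := by
      intro v hv
      rw [i1 v (fun h => hv h.1)]
      simp only [VarLang]
      rw [if_neg (fun h => hv (hsub h))]
    refine ⟨o1, fun v hv => ?_⟩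
    by_cases hC : v ∈ C
    · rw [i1 v (fun h => h.2 hC)]
      simp only [VarLang]
      rw [if_pos hC]
      congr 1
      refine Set.iInter₂_congr fun p hp => ?_
      obtain ⟨a1, a2⟩ := hCdef v hC p hp
      rw [o1 _ (hdis _ a1), o1 _ (hdis _ a2)]
    · rw [i2 v ⟨hv, hC⟩]
      congr 1
      simp only [VarLang]
      rw [if_neg hC]

/-- Completeness of forward-propagation under the tree property (Theorem 3). -/
theorem forwardProp_complete_tree {V a : Type}
    (S : Set V) (Concat : V → Set (V × V)) (Reg : V → Set (List a))
    (hwf : WfConstr S Concat Reg)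
    (hacy : ∃ l, Acyclic Concat S l)
    (htree : TreeProp Concat) :
    (∀ v ∈ S, ForwardProp S Concat Reg v ≠ ∅) ↔
      ∃ μ : V → List a, SatStr S Concat Reg μ := by
  obtain ⟨l, hl⟩ := hacy
  obtain ⟨r, hrb, hr⟩ := acyclic_rank Concat l S hl
  obtain ⟨-, hspec⟩ := forwardPropAux_spec Concat r S.ncard S ∅ Reg hwf.1 le_rfl (by simp)
    (fun v hv p hp => by simpa using hr v hv p hp)
  change ∀ v ∈ S, ForwardProp S Concat Reg v = Reg v ∩ ⋂ p ∈ Concat v,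
    langConcat (ForwardProp S Concat Reg p.1) (ForwardProp S Concat Reg p.2) at hspec
  generalize ForwardProp S Concat Reg = out at *
  constructor
  · intro hne
    obtain ⟨ht1, ht2, ht3⟩ := htree
    have huniq : ∀ v v' p q u, p ∈ Concat v → q ∈ Concat v' → (u = p.1 ∨ u = p.2) →
        (u = q.1 ∨ u = q.2) → v = v' ∧ p = q := by
      intro v v' p q u hp hq h1 h2
      have hmem : u ∈ ({p.1, p.2} ∩ {q.1, q.2} : Set V) := ⟨h1, h2⟩
      by_cases hv : v = v'
      · subst hv
        refine ⟨rfl, ?_⟩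
        by_contra hpq
        rw [ht2 v p hp q hq hpq] at hmem
        exact hmem
      · rw [ht3 v v' hv p hp q hq] at hmem
        exact hmem.elim
    have key : ∀ k m, m + k = l.length + 1 → ∃ μ : V → List a, (∀ v ∈ S, μ v ∈ out v) ∧
        ∀ v ∈ S, m ≤ r v → ∀ p ∈ Concat v, μ v = μ p.1 ++ μ p.2 := by
      intro k
      induction k with
      | zero =>
        intro m hm
        have : ∀ v, ∃ w, v ∈ S → w ∈ out v := by
          intro v
          by_cases hv : v ∈ S
          · obtain ⟨w, hw⟩ := Set.nonempty_iff_ne_empty.mpr (hne v hv)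
            exact ⟨w, fun _ => hw⟩
          · exact ⟨[], fun h => absurd h hv⟩
        choose μ hμ using this
        refine ⟨μ, hμ, fun v hv h => ?_⟩
        have := hrb v
        omega
      | succ k ih =>
        intro m hm
        obtain ⟨μ, h1, h2⟩ := ih (m + 1) (by omega)
        have hsplit : ∀ v p, ∃ w1 w2, v ∈ S → p ∈ Concat v →
            μ v = w1 ++ w2 ∧ w1 ∈ out p.1 ∧ w2 ∈ out p.2 := by
          intro v p
          by_cases h : v ∈ S ∧ p ∈ Concat v
          · have := h1 v h.1
            rw [hspec v h.1] at this
            obtain ⟨w1, w2, hw⟩ := Set.mem_iInter₂.mp this.2 p h.2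
            exact ⟨w1, w2, fun _ _ => hw⟩
          · exact ⟨[], [], fun a b => absurd ⟨a, b⟩ h⟩
        choose w1 w2 hw using hsplit
        have hex : ∀ u, ∃ w, (u ∈ S → w ∈ out u) ∧
            (∀ v ∈ S, r v = m → ∀ p ∈ Concat v,
              (u = p.1 → w = w1 v p) ∧ (u = p.2 → w = w2 v p)) ∧
            ((¬ ∃ v ∈ S, r v = m ∧ ∃ p ∈ Concat v, u = p.1 ∨ u = p.2) → w = μ u) := by
          intro u
          by_cases h : ∃ v ∈ S, r v = m ∧ ∃ p ∈ Concat v, u = p.1 ∨ u = p.2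
          · obtain ⟨v, hv, hrv, p, hp, hu⟩ := id h
            obtain ⟨-, s2, s3⟩ := hw v p hv hp
            have hne' := ht1 v p hp
            rcases hu with hu | hu
            · refine ⟨w1 v p, fun _ => hu ▸ s2, ?_, fun h' => absurd h h'⟩
              intro v' hv' _ q hq
              constructor
              · intro e
                obtain ⟨rfl, rfl⟩ := huniq v v' p q u hp hq (Or.inl hu) (Or.inl e)
                rfl
              · intro e
                obtain ⟨rfl, rfl⟩ := huniq v v' p q u hp hq (Or.inl hu) (Or.inr e)
                exact absurd (hu.symm.trans e) hne'
            · refine ⟨w2 v p, fun _ => hu ▸ s3, ?_, fun h' => absurd h h'⟩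
              intro v' hv' _ q hq
              constructor
              · intro e
                obtain ⟨rfl, rfl⟩ := huniq v v' p q u hp hq (Or.inr hu) (Or.inl e)
                exact absurd (e.symm.trans hu) hne'
              · intro e
                obtain ⟨rfl, rfl⟩ := huniq v v' p q u hp hq (Or.inr hu) (Or.inr e)
                rfl
          · refine ⟨μ u, h1 u, ?_, fun _ => rfl⟩
            intro v hv hrv p hp
            exact ⟨fun e => absurd ⟨v, hv, hrv, p, hp, Or.inl e⟩ h,
              fun e => absurd ⟨v, hv, hrv, p, hp, Or.inr e⟩ h⟩
        choose ν n1 n2 n3 using hex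
        refine ⟨ν, n1, fun v hv hmv p hp => ?_⟩
        have hvv : ν v = μ v := by
          apply n3
          rintro ⟨v', hv', hrv', q, hq, e⟩
          obtain ⟨-, a1, a2⟩ := hr v' hv' q hq
          rcases e with e | e <;> rw [e] at hmv <;> omega
        rw [hvv]
        rcases Nat.eq_or_lt_of_le hmv with hm' | hm'
        · rw [(n2 p.1 v hv hm'.symm p hp).1 rfl, (n2 p.2 v hv hm'.symm p hp).2 rfl]
          exact (hw v p hv hp).1
        · have hc : ∀ u, (u = p.1 ∨ u = p.2) → ν u = μ u := by
            intro u hu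
            apply n3
            rintro ⟨v', hv', hrv', q, hq, e⟩
            obtain ⟨rfl, -⟩ := huniq v v' p q u hp hq hu e
            omega
          rw [hc p.1 (Or.inl rfl), hc p.2 (Or.inr rfl)]
          exact h2 v hv hm' p hp
    obtain ⟨μ, m1, m2⟩ := key (l.length + 1) 0 (by omega)
    refine ⟨μ, fun v hv => ?_, fun v hv => m2 v hv (Nat.zero_le _)⟩
    have := m1 v hv
    rw [hspec v hv] at this
    exact this.1
  · rintro ⟨μ, m1, m2⟩
    have key : ∀ k v, r v < k → v ∈ S → μ v ∈ out v := by
      intro k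
      induction k with
      | zero => intro v h; omega
      | succ k ih =>
        intro v h hv
        rw [hspec v hv]
        refine ⟨m1 v hv, Set.mem_iInter₂.mpr fun p hp => ?_⟩
        obtain ⟨⟨a1, a2⟩, a3, a4⟩ := hr v hv p hp
        exact ⟨μ p.1, μ p.2, m2 v hv p hp, ih _ (by omega) a1, ih _ (by omega) a2⟩
    intro v hv
    exact Set.nonempty_iff_ne_empty.mp ⟨_, key _ v (Nat.lt_succ_self _) hv⟩
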